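/- Let A be a finite idempotent algebra. Then the variety V(A) has a difference term if and only if every subalgebra of A × A generated by at most three elements has a difference term operation. -/

import Mathlib

open FirstOrder FirstOrder.Language FirstOrder.Language.Structure

/-- A congruence on an `L`-structure: an equivalence relation preserved by every
basic operation. -/
def IsCong (L : FirstOrder.Language) (A : Type*) [L.Structure A] (r : A → A → Prop) : Prop :=
  Equivalence r ∧ ∀ (n : ℕ) (f : L.Functions n) (x y : Fin n → A),
    (∀ i, r (x i) (y i)) → r (funMap f x) (funMap f y)

/-- The congruence generated by a set of pairs: the intersection of all congruences
containing the set. -/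
def cgSet (L : FirstOrder.Language) (A : Type*) [L.Structure A] (s : Set (A × A)) :
    A → A → Prop :=
  fun x y => ∀ r : A → A → Prop, IsCong L A r → (∀ p ∈ s, r p.1 p.2) → r x y

/-- `Cg^A(a,b)`: the least congruence containing `(a,b)`. -/
def cgPair (L : FirstOrder.Language) (A : Type*) [L.Structure A] (a b : A) : A → A → Prop :=
  cgSet L A {(a, b)}

/-- The term condition `C(α,β;δ)`. -/
def TermCond (L : FirstOrder.Language) (A : Type*) [L.Structure A]
    (α β δ : A → A → Prop) : Prop :=
  ∀ (n : ℕ) (t : L.Term (Fin (n + 1))) (a a' : A), α a a' →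
    ∀ u v : Fin n → A, (∀ i, β (u i) (v i)) →
      δ (t.realize (Fin.cons a u)) (t.realize (Fin.cons a v)) →
      δ (t.realize (Fin.cons a' u)) (t.realize (Fin.cons a' v))

/-- The commutator `[α,β]`: the least congruence `δ` such that `C(α,β;δ)` holds
(the intersection of all such `δ`). -/
def commut (L : FirstOrder.Language) (A : Type*) [L.Structure A] (α β : A → A → Prop) :
    A → A → Prop :=
  fun x y => ∀ δ : A → A → Prop, IsCong L A δ → TermCond L A α β δ → δ x y

/-- An algebra is idempotent if every basic operation satisfies `f(a,…,a) = a`. -/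
def IsIdem (L : FirstOrder.Language) (A : Type*) [L.Structure A] : Prop :=
  ∀ (n : ℕ) (f : L.Functions n) (a : A), funMap f (fun _ => a) = a

/-- A ternary term `d` is a difference term operation for `A` if `d(a,a,b) = b` and
`(a, d(a,b,b)) ∈ [θ,θ]` where `θ = Cg^A(a,b)`. -/
def IsDTO (L : FirstOrder.Language) (A : Type*) [L.Structure A] (d : L.Term (Fin 3)) : Prop :=
  ∀ a b : A, d.realize ![a, a, b] = b ∧
    commut L A (cgPair L A a b) (cgPair L A a b) a (d.realize ![a, b, b])

/-- A local difference term operation for a triple `(a, b, i) ∈ A² × {0,1}`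
(`i = 1` is encoded as `true`). -/
def IsLDTO (L : FirstOrder.Language) (A : Type*) [L.Structure A] (t : L.Term (Fin 3))
    (s : A × A × Bool) : Prop :=
  if s.2.2 then t.realize ![s.1, s.1, s.2.1] = s.2.1
  else commut L A (cgPair L A s.1 s.2.1) (cgPair L A s.1 s.2.1) s.1
    (t.realize ![s.1, s.2.1, s.2.1])

/-- The coordinatewise `L`-structure on a product. -/
def prodStructure (L : FirstOrder.Language) (A B : Type*) [L.Structure A] [L.Structure B] :
    L.Structure (A × B) where
  funMap f x := (funMap f fun i => (x i).1, funMap f fun i => (x i).2)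
  RelMap r x := RelMap r (fun i => (x i).1) ∧ RelMap r (fun i => (x i).2)

/-- The quotient structure on `Quotient s` induced by the structure on `A`. -/
noncomputable def quotStructure (L : FirstOrder.Language) (A : Type*) [L.Structure A] (s : Setoid A) :
    L.Structure (Quotient s) where
  funMap f x := ⟦funMap f fun i => (x i).out⟧
  RelMap r x := RelMap r fun i => (x i).out

universe u v

section Clone

open Function

/-- A clone of idempotent operations on `Q` satisfying the term condition, stated for tuples. -/
structure IsAbelianClone {Q : Type*} (C : ∀ n : ℕ, Set ((Fin n → Q) → Q)) : Prop where
  proj : ∀ n (i : Fin n), (fun x => x i) ∈ C n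
  comp : ∀ {n m f}, f ∈ C n → ∀ {g : Fin n → (Fin m → Q) → Q}, (∀ i, g i ∈ C m) →
    (fun x => f fun i => g i x) ∈ C m
  idem : ∀ {n f}, f ∈ C n → ∀ a, f (fun _ => a) = a
  rect : ∀ {n f}, f ∈ C n → ∀ w₁ w₂ w₃ w₄ : Fin n → Q,
    (∀ i, w₁ i = w₂ i ∧ w₃ i = w₄ i ∨ w₁ i = w₃ i ∧ w₂ i = w₄ i) → f w₁ = f w₂ → f w₃ = f w₄

/-- The clone contains a Maltsev operation. -/
def HasMaltsev {Q : Type*} (C : ∀ n : ℕ, Set ((Fin n → Q) → Q)) : Prop :=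
  ∃ m : Q → Q → Q → Q, (fun v : Fin 3 → Q => m (v 0) (v 1) (v 2)) ∈ C 3 ∧
    (∀ x y, m x y y = x) ∧ ∀ x y, m x x y = y

/-- A homomorphism from the clone to the clone of projections. -/
def HasProjHom {Q : Type*} (C : ∀ n : ℕ, Set ((Fin n → Q) → Q)) : Prop :=
  ∃ ξ : ∀ n f, f ∈ C n → Fin n, (∀ n i h, ξ n (fun x => x i) h = i) ∧
    ∀ n m f (hf : f ∈ C n) (g : Fin n → (Fin m → Q) → Q) (hg : ∀ i, g i ∈ C m) h,
      ξ m (fun x => f fun i => g i x) h = ξ m (g (ξ n f hf)) (hg _)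

/-- An operation is injective in its `i`-th argument. -/
def InjAt {Q : Type*} {n : ℕ} (f : (Fin n → Q) → Q) (i : Fin n) : Prop :=
  ∀ v a b, f (update v i a) = f (update v i b) → a = b

theorem exists_iterate_add_self {α : Type*} [Finite α] (f : α → α) :
    ∃ N, 0 < N ∧ f^[N + N] = f^[N] := by
  obtain ⟨i, j, hne, hij⟩ := Finite.exists_ne_map_eq_of_infinite fun n : ℕ => f^[n]
  wlog hlt : i < j generalizing i j
  · exact this j i hne.symm hij.symm (by omega)
  obtain ⟨p, rfl⟩ := Nat.exists_eq_add_of_lt hlt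
  have hper : ∀ n, f^[i + n + (p + 1)] = f^[i + n] := fun n => by
    rw [show i + n + (p + 1) = n + (i + p + 1) by ring, add_comm i n, iterate_add f n (i + p + 1),
      iterate_add f n i]
    exact congrArg _ hij.symm
  have hmul : ∀ k n, f^[i + n + k * (p + 1)] = f^[i + n] := fun k => by
    induction k with
    | zero => simp
    | succ k ih =>
      intro n
      rw [show i + n + (k + 1) * (p + 1) = i + (n + k * (p + 1)) + (p + 1) by ring, hper,
        ← add_assoc, ih]
  refine ⟨(i + 1) * (p + 1), by positivity, ?_⟩
  obtain ⟨n, hn⟩ : ∃ n, (i + 1) * (p + 1) = i + n := ⟨i * p + p + 1, by ring⟩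
  have := hmul (i + 1) n
  rwa [← hn] at this

theorem exists_iterate_idem {Q : Type*} [Finite Q] (q : Q → Q → Q) :
    ∃ N, 0 < N ∧ ∀ x y, (fun z => q z y)^[N] ((fun z => q z y)^[N] x) = (fun z => q z y)^[N] x := by
  obtain ⟨N, hN, h⟩ := exists_iterate_add_self fun z : Q × Q => (q z.1 z.2, z.2)
  have key : ∀ n x y, (fun z : Q × Q => (q z.1 z.2, z.2))^[n] (x, y) =
      ((fun z => q z y)^[n] x, y) := fun n => by
    induction n with
    | zero => simp
    | succ n ih => simp [ih]
  refine ⟨N, hN, fun x y => ?_⟩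
  have := congrArg Prod.fst (congrFun h (x, y))
  simpa only [key, iterate_add_apply] using this

namespace IsAbelianClone

variable {Q : Type*} {C : ∀ n : ℕ, Set ((Fin n → Q) → Q)}

theorem comp₂ (hC : IsAbelianClone C) {e : Q → Q → Q}
    (he : (fun v : Fin 2 → Q => e (v 0) (v 1)) ∈ C 2) {n} {g h : (Fin n → Q) → Q}
    (hg : g ∈ C n) (hh : h ∈ C n) : (fun x => e (g x) (h x)) ∈ C n := by
  have := hC.comp he (g := ![g, h]) (by intro i; fin_cases i <;> assumption)
  simpa using this

theorem comp₃ (hC : IsAbelianClone C) {e : Q → Q → Q → Q}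
    (he : (fun v : Fin 3 → Q => e (v 0) (v 1) (v 2)) ∈ C 3) {n} {g h k : (Fin n → Q) → Q}
    (hg : g ∈ C n) (hh : h ∈ C n) (hk : k ∈ C n) : (fun x => e (g x) (h x) (k x)) ∈ C n := by
  have := hC.comp he (g := ![g, h, k]) (by intro i; fin_cases i <;> assumption)
  simpa using this

theorem iterate (hC : IsAbelianClone C) {n m} {f : (Fin (n + 1) → Q) → Q} (hf : f ∈ C (n + 1))
    {g : Fin n → (Fin m → Q) → Q} (hg : ∀ i, g i ∈ C m) {h : (Fin m → Q) → Q} (hh : h ∈ C m)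
    (k : ℕ) : (fun v => (fun x => f (Fin.cons x fun i => g i v))^[k] (h v)) ∈ C m := by
  induction k with
  | zero => exact hh
  | succ k ih =>
    simp only [iterate_succ_apply']
    have := hC.comp hf (m := m)
      (g := Fin.cons (fun v => (fun x => f (Fin.cons x fun i => g i v))^[k] (h v)) g)
      (Fin.cases ih hg)
    convert this using 3 with v
    funext i
    refine Fin.cases ?_ (fun i => ?_) i <;> simp

theorem iterate₂ (hC : IsAbelianClone C) {q : Q → Q → Q}
    (hq : (fun v : Fin 2 → Q => q (v 0) (v 1)) ∈ C 2) (k : ℕ) :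
    (fun v : Fin 2 → Q => (fun x => q x (v 1))^[k] (v 0)) ∈ C 2 := by
  have := hC.iterate hq (g := fun _ v => v 1) (fun _ => hC.proj 2 1) (hC.proj 2 0) k
  simpa using this

theorem rect_left (hC : IsAbelianClone C) {e : Q → Q → Q}
    (he : (fun v : Fin 2 → Q => e (v 0) (v 1)) ∈ C 2) {x x' y : Q} (z : Q)
    (h : e x y = e x' y) : e x z = e x' z := by
  have := hC.rect he ![x, y] ![x', y] ![x, z] ![x', z] (by intro i; fin_cases i <;> simp)
  exact this h

theorem rect_right (hC : IsAbelianClone C) {e : Q → Q → Q}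
    (he : (fun v : Fin 2 → Q => e (v 0) (v 1)) ∈ C 2) {x y y' : Q} (z : Q)
    (h : e x y = e x y') : e z y = e z y' := by
  have := hC.rect he ![x, y] ![x, y'] ![z, y] ![z, y'] (by intro i; fin_cases i <;> simp)
  exact this h

theorem idem₂ (hC : IsAbelianClone C) {e : Q → Q → Q}
    (he : (fun v : Fin 2 → Q => e (v 0) (v 1)) ∈ C 2) (x : Q) : e x x = x :=
  hC.idem he x

theorem notMem_zero [Nontrivial Q] (hC : IsAbelianClone C) (f) : f ∉ C 0 := fun hf => by
  obtain ⟨a, b, hab⟩ := exists_pair_ne Q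
  apply hab
  rw [← hC.idem hf a, ← hC.idem hf b]
  exact congrArg f (Subsingleton.elim _ _)

theorem injAt_of_injective (hC : IsAbelianClone C) {n f} (hf : f ∈ C n) (i : Fin n) (b : Q)
    (h : Injective fun x => f (update (fun _ => b) i x)) : InjAt f i := by
  classical
  intro v x y hxy
  refine h (hC.rect hf _ _ _ _ (fun j => ?_) hxy)
  by_cases hj : j = i
  · subst hj; simp
  · simp [hj]

theorem exists_left_inverse [Finite Q] (hC : IsAbelianClone C) {q : Q → Q → Q}
    (hq : (fun v : Fin 2 → Q => q (v 0) (v 1)) ∈ C 2) {b : Q} (hb : Injective fun x => q x b) :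
    ∃ r : Q → Q → Q, (fun v : Fin 2 → Q => r (v 0) (v 1)) ∈ C 2 ∧
      (∀ x y, r (q x y) y = x) ∧ ∀ x y, q (r x y) y = x := by
  obtain ⟨N, hN, h⟩ := exists_iterate_idem q
  obtain ⟨k, rfl⟩ := Nat.exists_eq_succ_of_ne_zero hN.ne'
  have hinj : ∀ y, Injective fun x => q x y := fun y x x' hx => hb (hC.rect_left hq b hx)
  have hid : ∀ x y, (fun z => q z y)^[k + 1] x = x := fun x y => (hinj y).iterate _ (h x y)
  refine ⟨fun x y => (fun z => q z y)^[k] x, hC.iterate₂ hq k, fun x y => ?_, fun x y => ?_⟩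
  · simpa [iterate_succ_apply] using hid x y
  · simpa only [iterate_succ_apply'] using hid x y

theorem hasMaltsev_of_injective [Finite Q] (hC : IsAbelianClone C) {g : Q → Q → Q → Q}
    (hg : (fun v : Fin 3 → Q => g (v 0) (v 1) (v 2)) ∈ C 3) (b : Q)
    (h₁ : Injective fun x => g x b b) (h₂ : Injective fun z => g b b z) : HasMaltsev C := by
  have p₂ := hC.proj 2
  have p₃ := hC.proj 3
  have hq : (fun v : Fin 2 → Q => g (v 0) (v 1) (v 1)) ∈ C 2 := hC.comp₃ hg (p₂ 0) (p₂ 1) (p₂ 1)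
  have hq' : (fun v : Fin 2 → Q => g (v 1) (v 1) (v 0)) ∈ C 2 := hC.comp₃ hg (p₂ 1) (p₂ 1) (p₂ 0)
  obtain ⟨r, hr, hr₁, -⟩ := hC.exists_left_inverse (q := fun x y => g x y y) hq h₁
  obtain ⟨r', hr', -, hr₂⟩ := hC.exists_left_inverse (q := fun x y => g y y x) hq' h₂
  refine ⟨fun x y z => r (g x y (r' (g z y y) y)) y, ?_, fun x y => ?_, fun x y => ?_⟩
  · exact hC.comp₂ hr (hC.comp₃ hg (p₃ 0) (p₃ 1)
      (hC.comp₂ hr' (hC.comp₃ hg (p₃ 2) (p₃ 1) (p₃ 1)) (p₃ 1))) (p₃ 1)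
  · simp only [hC.idem hg y |> (show g y y y = y from ·), hC.idem₂ hr' y]
    exact hr₁ x y
  · dsimp only at hr₂ ⊢
    rw [hr₂]; exact hr₁ y x

theorem eq_of_injAt [Finite Q] (hC : IsAbelianClone C) (hM : ¬ HasMaltsev C) {n f} (hf : f ∈ C n)
    {i j : Fin n} (hi : InjAt f i) (hj : InjAt f j) : i = j := by
  classical
  by_contra hij
  apply hM
  rcases isEmpty_or_nonempty Q with hQ | ⟨⟨b⟩⟩
  · exact ⟨fun x _ _ => x, hC.proj 3 0, fun x => hQ.elim x, fun x => hQ.elim x⟩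
  refine hC.hasMaltsev_of_injective
    (g := fun x y z => f fun k => if k = i then x else if k = j then z else y)
    (hC.comp hf fun k => ?_) b (fun x x' h => hi (fun _ => b) x x' ?_)
    (fun x x' h => hj (fun _ => b) x x' ?_)
  · split_ifs <;> exact hC.proj 3 _
  · convert h using 2 <;> (funext k; by_cases hk : k = i <;> simp [hk])
  · convert h using 2 <;> (funext k; by_cases hk : k = j <;> simp [hk, Ne.symm hij])

/-- Iterating a binary operation of a finite abelian clone in its first argument yields a
rectangular band operation. -/
theorem exists_rectangular [Finite Q] (hC : IsAbelianClone C) {q : Q → Q → Q}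
    (hq : (fun v : Fin 2 → Q => q (v 0) (v 1)) ∈ C 2) :
    ∃ N, 0 < N ∧ (∀ x y z, (fun w => q w z)^[N] ((fun w => q w y)^[N] x) = (fun w => q w z)^[N] x) ∧
      ∀ x y z, (fun w => q w ((fun w => q w y)^[N] x))^[N] z = (fun w => q w y)^[N] z := by
  obtain ⟨N, hN, h⟩ := exists_iterate_idem q
  set e : Q → Q → Q := fun x y => (fun w => q w y)^[N] x with he'
  have he : (fun v : Fin 2 → Q => e (v 0) (v 1)) ∈ C 2 := hC.iterate₂ hq N
  have h₁ : ∀ x y z, e (e x y) z = e x z := fun x y z => hC.rect_left he z (h x y)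
  refine ⟨N, hN, h₁, fun x y z => ?_⟩
  have h₂ : e x (e x y) = e x y := by rw [← h₁ x y (e x y), hC.idem₂ he]
  exact hC.rect_right he z h₂

section Local

variable [Finite Q] [Nontrivial Q]

/-- The only rectangular band operations in the clone are projections. -/
def IsLocal (C : ∀ n : ℕ, Set ((Fin n → Q) → Q)) : Prop :=
  ∀ e : Q → Q → Q, (fun v : Fin 2 → Q => e (v 0) (v 1)) ∈ C 2 →
    (∀ x y z, e (e x y) z = e x z) → (∀ x y z, e z (e x y) = e z y) →
      (∀ x y, e x y = x) ∨ ∀ x y, e x y = y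

theorem exists_injAt (hC : IsAbelianClone C) (hL : IsLocal C) :
    ∀ n f, f ∈ C n → ∃ i, InjAt f i
  | 0, f, hf => (hC.notMem_zero f hf).elim
  | 1, f, hf => by
    refine ⟨0, fun v a b h => ?_⟩
    have key : ∀ c, update v 0 c = fun _ => c := fun c => by
      funext i; rw [Subsingleton.elim i 0, update_self]
    rwa [key, key, hC.idem hf, hC.idem hf] at h
  | m + 2, f, hf => by
    obtain ⟨b⟩ : Nonempty Q := inferInstance
    have hq : (fun v : Fin 2 → Q => f (Fin.cons (v 0) fun _ => v 1)) ∈ C 2 := by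
      have := hC.comp hf (g := (Fin.cons (fun v : Fin 2 → Q => v 0) fun _ v => v 1))
        (Fin.cases (hC.proj 2 0) fun _ => hC.proj 2 1)
      convert this using 3 with v
      funext i
      refine Fin.cases ?_ (fun i => ?_) i <;> simp
    obtain ⟨N, hN, h₁, h₂⟩ := hC.exists_rectangular (q := fun x y => f (Fin.cons x fun _ => y)) hq
    rcases hL (fun x y => (fun w => f (Fin.cons w fun _ => y))^[N] x)
      (hC.iterate₂ (q := fun x y => f (Fin.cons x fun _ => y)) hq N) h₁ h₂ with h | h
    · refine ⟨0, hC.injAt_of_injective hf 0 b fun x x' hx => ?_⟩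
      obtain ⟨k, rfl⟩ := Nat.exists_eq_succ_of_ne_zero hN.ne'
      have hu : ∀ x : Q, update (fun _ : Fin (m + 2) => b) 0 x = Fin.cons x fun _ => b :=
        fun x => by
          funext i
          refine Fin.cases ?_ (fun i => ?_) i <;> simp
      simp only [hu] at hx
      rw [← h x b, ← h x' b, iterate_succ_apply, iterate_succ_apply]
      exact congrArg _ hx
    · set H : (Fin (m + 2) → Q) → Q :=
        fun v => (fun x => f (Fin.cons x fun i => v (Fin.succ i)))^[N] (v 0) with hH
      have hHC : H ∈ C (m + 2) :=
        hC.iterate hf (g := fun i v => v (Fin.succ i)) (fun i => hC.proj _ _) (hC.proj _ 0) N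
      have hind : ∀ x x' (w : Fin (m + 1) → Q), H (Fin.cons x w) = H (Fin.cons x' w) := by
        intro x x' w
        refine hC.rect hHC (Fin.cons x fun _ => b) (Fin.cons x' fun _ => b) _ _
          (Fin.cases (by simp) (fun i => by simp)) ?_
        simp only [hH, Fin.cons_zero, Fin.cons_succ]
        exact (h x b).trans (h x' b).symm
      have hG : (fun w : Fin (m + 1) → Q => H (Fin.cons (w 0) w)) ∈ C (m + 1) := by
        have := hC.comp hHC (g := (Fin.cons (fun v : Fin (m + 1) → Q => v 0) fun i v => v i))
          (Fin.cases (hC.proj _ 0) fun i => hC.proj _ i)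
        convert this using 2
        congr 1
      obtain ⟨i, hi⟩ := exists_injAt hC hL _ _ hG
      refine ⟨i.succ, hC.injAt_of_injective hf _ b fun x x' hx => hi (fun _ => b) x x' ?_⟩
      have hu : ∀ x : Q, update (fun _ : Fin (m + 2) => b) i.succ x =
          Fin.cons b (update (fun _ => b) i x) := fun x => by
        rw [Fin.cons_update]
        congr 1
        funext i
        refine Fin.cases ?_ (fun i => ?_) i <;> simp
      simp only [hu] at hx
      have hf' : ∀ z, f (Fin.cons z (update (fun _ => b) i x)) =
          f (Fin.cons z (update (fun _ => b) i x')) := fun z =>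
        hC.rect hf _ _ _ _ (Fin.cases (by simp) (fun i => by simp)) hx
      dsimp only
      rw [hind _ b, hind (update (fun _ => b) i x' 0) b]
      simp only [hH, Fin.cons_succ, Fin.cons_zero]
      exact congrArg (fun F : Q → Q => F^[N] b) (funext hf')

theorem hasProjHom_of_isLocal (hC : IsAbelianClone C) (hL : IsLocal C) (hM : ¬ HasMaltsev C) :
    HasProjHom C := by
  classical
  choose ξ hξ using hC.exists_injAt hL
  have huniq : ∀ {n f} (hf : f ∈ C n) {i}, InjAt f i → ξ n f hf = i := fun hf i hi =>
    hC.eq_of_injAt hM hf (hξ _ _ hf) hi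
  refine ⟨ξ, fun n i h => huniq h fun v a b hab => by simpa using hab,
    fun n m f hf g hg h => ?_⟩
  obtain ⟨b⟩ : Nonempty Q := inferInstance
  set k := ξ n f hf with hk
  set j := ξ m (g k) (hg k) with hj
  set j' := ξ m _ h with hj'
  by_contra hne
  set G : (Fin (m + 1) → Q) → Q := fun v =>
    f fun l => if l = k then g k (update (Fin.tail v) j (v 0)) else g l (Fin.tail v) with hG
  have htail : ∀ {p : (Fin m → Q) → Q}, p ∈ C m → (fun v : Fin (m + 1) → Q => p (Fin.tail v)) ∈
      C (m + 1) := fun hp => hC.comp hp fun i => hC.proj _ i.succ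
  have hGC : G ∈ C (m + 1) := by
    refine hC.comp hf (g := fun l v =>
      if l = k then g k (update (Fin.tail v) j (v 0)) else g l (Fin.tail v)) fun l => ?_
    by_cases hl : l = k
    · simp only [hl, if_true]
      refine hC.comp (hg k) (g := fun i v => update (Fin.tail v) j (v 0) i) fun i => ?_
      by_cases hi : i = j
      · subst hi; simpa using hC.proj _ _
      · simp only [update_of_ne hi]; exact hC.proj _ i.succ
    · simpa only [hl, if_false] using htail (hg l)
  have h0 : InjAt G 0 := by
    refine hC.injAt_of_injective hGC 0 b fun x x' hx => hξ _ _ (hg k) (fun _ => b) x x' ?_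
    refine hξ _ _ hf (fun l => g l fun _ => b) _ _ ?_
    convert hx using 2 <;>
    · funext l
      by_cases hl : l = k
      · subst hl; simp [Fin.tail_def, hj, hk]
      · simp [← hk, hl, Fin.tail_def]
  have h1 : InjAt G j'.succ := by
    refine hC.injAt_of_injective hGC _ b fun x x' hx => hξ _ _ h (fun _ => b) x x' ?_
    have key : ∀ x, G (update (fun _ => b) j'.succ x) =
        f fun l => g l (update (fun _ => b) j' x) := by
      intro x
      have ht : Fin.tail (update (fun _ : Fin (m + 1) => b) j'.succ x) =
          update (fun _ => b) j' x := by
        rw [Fin.tail_update_succ]; rfl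
      simp only [hG, ht]
      congr 1
      funext l
      by_cases hl : l = k
      · subst hl
        simp only [if_true]
        congr 1
        have : (update (fun _ : Fin (m + 1) => b) j'.succ x) 0 = update (fun _ => b) j' x j := by
          rw [update_of_ne (Fin.succ_ne_zero _).symm, update_of_ne (Ne.symm hne)]
        rw [this, update_eq_self]
      · simp [hl]
    simp only [key] at hx
    exact hx
  exact Fin.succ_ne_zero _ (hC.eq_of_injAt hM hGC h1 h0)

end Local

section Corner

/-- The image of a rectangular band operation with its second argument fixed. -/
abbrev Corner (e : Q → Q → Q) (b : Q) : Type _ := {x : Q // e x b = x}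

/-- The operation induced on a corner. -/
def cornerOp {e : Q → Q → Q} (h₁ : ∀ x y z, e (e x y) z = e x z) (b : Q) {n : ℕ}
    (f : (Fin n → Q) → Q) (x : Fin n → Corner e b) : Corner e b :=
  ⟨e (f fun i => x i) b, h₁ _ _ _⟩

/-- The clone induced on a corner. -/
def cornerClone (C : ∀ n : ℕ, Set ((Fin n → Q) → Q)) {e : Q → Q → Q}
    (h₁ : ∀ x y z, e (e x y) z = e x z) (b : Q) (n : ℕ) :
    Set ((Fin n → Corner e b) → Corner e b) :=
  cornerOp h₁ b '' C n

variable {e : Q → Q → Q}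

theorem cornerClone_isAbelianClone [Nontrivial Q] (hC : IsAbelianClone C)
    (he : (fun v : Fin 2 → Q => e (v 0) (v 1)) ∈ C 2)
    (h₁ : ∀ x y z, e (e x y) z = e x z) (h₂ : ∀ x y z, e z (e x y) = e z y) (b : Q) :
    IsAbelianClone (cornerClone C h₁ b) where
  proj n i := ⟨_, hC.proj n i, funext fun x => Subtype.ext (x i).2⟩
  comp := by
    rintro n m _ ⟨f, hf, rfl⟩ g hg
    choose g' hg' hgg' using hg
    obtain _ | m := m
    · obtain _ | n := n
      · exact (hC.notMem_zero _ hf).elim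
      · exact (hC.notMem_zero _ (hg' 0)).elim
    refine ⟨fun x => f fun i => e (g' i x) (x 0),
      hC.comp hf fun i => hC.comp₂ he (hg' i) (hC.proj _ 0), funext fun x => Subtype.ext ?_⟩
    simp only [cornerOp, ← hgg']
    congr 2
    funext i
    rw [← (x 0).2, h₂]
  idem := by
    rintro n _ ⟨f, hf, rfl⟩ a
    exact Subtype.ext (by simp [cornerOp, hC.idem hf, a.2])
  rect := by
    rintro n _ ⟨f, hf, rfl⟩ w₁ w₂ w₃ w₄ hw h
    have hF : (fun v : Fin (n + 1) → Q => e (f (Fin.tail v)) (v 0)) ∈ C (n + 1) :=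
      hC.comp₂ he (hC.comp hf fun i => hC.proj _ i.succ) (hC.proj _ 0)
    have := hC.rect hF (Fin.cons b fun i => w₁ i) (Fin.cons b fun i => w₂ i)
      (Fin.cons b fun i => w₃ i) (Fin.cons b fun i => w₄ i)
      (Fin.cases (by simp) fun i => by simpa [Subtype.ext_iff] using hw i)
    simp only [Fin.tail_cons, Fin.cons_zero] at this
    exact Subtype.ext (this (congrArg Subtype.val h))

theorem card_corner_lt [Finite Q] (h₁ : ∀ x y z, e (e x y) z = e x z) (b : Q)
    (h : ¬ ∀ x y, e x y = x) : Nat.card (Corner e b) < Nat.card Q := by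
  push Not at h
  obtain ⟨x, y, hxy⟩ := h
  by_cases hx : e x b = x
  · exact Finite.card_subtype_lt (x := e x y) fun h => hxy (by rw [← h, h₁, hx])
  · exact Finite.card_subtype_lt hx

theorem hasProjHom_of_cornerClone (hC : IsAbelianClone C)
    (he : (fun v : Fin 2 → Q => e (v 0) (v 1)) ∈ C 2)
    (h₁ : ∀ x y z, e (e x y) z = e x z) (h₂ : ∀ x y z, e z (e x y) = e z y) (b : Q)
    (h : HasProjHom (cornerClone C h₁ b)) : HasProjHom C := by
  obtain ⟨ξ, hproj, hcomp⟩ := h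
  have hcongr : ∀ {n f g} (hf : f ∈ cornerClone C h₁ b n) (hg : g ∈ cornerClone C h₁ b n),
      f = g → ξ n f hf = ξ n g hg := by rintro n f _ hf hg rfl; rfl
  have hp : ∀ n (i : Fin n), (fun x : Fin n → Corner e b => x i) ∈ cornerClone C h₁ b n :=
    fun n i => ⟨_, hC.proj n i, funext fun x => Subtype.ext (x i).2⟩
  refine ⟨fun n f hf => ξ n (cornerOp h₁ b f) ⟨f, hf, rfl⟩, fun n i h => ?_,
    fun n m f hf g hg h => ?_⟩
  · exact (hcongr _ (hp n i) (funext fun x => Subtype.ext (x i).2)).trans (hproj _ _ _)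
  set H : (Fin (n + m) → Q) → Q := fun v =>
    f fun k => e (v (Fin.castAdd m k)) (g k fun i => v (Fin.natAdd n i)) with hH
  have hHC : H ∈ C (n + m) := hC.comp hf fun k =>
    hC.comp₂ he (hC.proj _ _) (hC.comp (hg k) fun i => hC.proj _ _)
  have hHD : cornerOp h₁ b H ∈ cornerClone C h₁ b (n + m) := ⟨H, hHC, rfl⟩
  have hfD : cornerOp h₁ b f ∈ cornerClone C h₁ b n := ⟨f, hf, rfl⟩
  have hgD : ∀ k, cornerOp h₁ b (g k) ∈ cornerClone C h₁ b m := fun k => ⟨g k, hg k, rfl⟩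
  have hJ : ∀ j : Fin (n + m), (fun v : Fin (n + 1) → Corner e b =>
      v (Fin.addCases (fun k => k.castSucc) (fun _ => Fin.last n) j)) ∈
        cornerClone C h₁ b (n + 1) := fun j => hp _ _
  have hK : (fun v : Fin (n + 1) → Corner e b => cornerOp h₁ b H fun j =>
      v (Fin.addCases (fun k => k.castSucc) (fun _ => Fin.last n) j)) =
      fun v => cornerOp h₁ b f fun k => v k.castSucc := by
    funext v
    refine Subtype.ext ?_
    simp only [cornerOp, hH, Fin.addCases_left, Fin.addCases_right, hC.idem (hg _)]
    congr 2
    funext k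
    rw [← (v (Fin.last n)).2, h₂, (v k.castSucc).2]
  have hKD : (fun v : Fin (n + 1) → Corner e b => cornerOp h₁ b H fun j =>
      v (Fin.addCases (fun k => k.castSucc) (fun _ => Fin.last n) j)) ∈
      cornerClone C h₁ b (n + 1) := by
    rw [hK]; exact ⟨_, hC.comp hf fun k => hC.proj _ k.castSucc, rfl⟩
  have hidx := hcomp _ _ _ hHD _ hJ hKD
  rw [hcongr hKD (by rw [← hK]; exact hKD) hK,
    hcomp _ _ _ hfD (fun k v => v k.castSucc) (fun k => hp _ _), hproj, hproj] at hidx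
  have hk : ξ _ _ hHD = Fin.castAdd m (ξ _ _ hfD) := by
    revert hidx
    refine Fin.addCases (fun k => ?_) (fun i => ?_) (ξ _ _ hHD)
    · rw [Fin.addCases_left]
      intro h
      rw [Fin.castSucc_injective _ h]
    · rw [Fin.addCases_right]
      exact fun h => (Fin.castSucc_ne_last _ h).elim
  have hG : ∀ j : Fin (n + m), Fin.addCases (motive := fun _ => (Fin m → Corner e b) → Corner e b)
      (fun k => cornerOp h₁ b (g k)) (fun i x => x i) j ∈ cornerClone C h₁ b m := by
    refine Fin.addCases (fun k => ?_) (fun i => ?_)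
    · rw [Fin.addCases_left]; exact hgD k
    · rw [Fin.addCases_right]; exact hp _ _
  have hL : cornerOp h₁ b (fun x => f fun k => g k x) = fun x => cornerOp h₁ b H fun j =>
      Fin.addCases (motive := fun _ => (Fin m → Corner e b) → Corner e b)
        (fun k => cornerOp h₁ b (g k)) (fun i x => x i) j x := by
    funext x
    refine Subtype.ext ?_
    simp only [cornerOp, hH, Fin.addCases_left, Fin.addCases_right, h₁, hC.idem₂ he]
  have hLD : (fun x => cornerOp h₁ b H fun j =>
      Fin.addCases (motive := fun _ => (Fin m → Corner e b) → Corner e b)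
        (fun k => cornerOp h₁ b (g k)) (fun i x => x i) j x) ∈ cornerClone C h₁ b m := by
    rw [← hL]; exact ⟨_, h, rfl⟩
  refine (hcongr _ hLD hL).trans ((hcomp _ _ _ hHD _ hG hLD).trans (hcongr _ _ ?_))
  rw [hk, Fin.addCases_left]

theorem hasMaltsev_of_corners [Finite Q] (hC : IsAbelianClone C)
    (he : (fun v : Fin 2 → Q => e (v 0) (v 1)) ∈ C 2)
    (h₁ : ∀ x y z, e (e x y) z = e x z) (h₂ : ∀ x y z, e z (e x y) = e z y) (b : Q)
    (h : HasMaltsev (cornerClone C h₁ b))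
    (h' : HasMaltsev (cornerClone C (e := fun x y => e y x) (fun x y z => h₂ y x z) b)) :
    HasMaltsev C := by
  obtain ⟨m, ⟨F, hF, hFm⟩, hm₁, hm₂⟩ := h
  obtain ⟨m', ⟨F', hF', hFm'⟩, hm₁', hm₂'⟩ := h'
  have hb : e b b = b := hC.idem₂ he b
  have p := hC.proj 3
  have hM : ∀ x y z : Corner e b, e (F ![x, y, z]) b = m x y z := fun x y z => by
    refine Eq.trans ?_ (congrArg Subtype.val (congrFun hFm ![x, y, z]))
    simp only [cornerOp]
    congr 2
    funext i; fin_cases i <;> rfl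
  have hM' : ∀ x y z : Corner (fun x y => e y x) b, e b (F' ![x, y, z]) = m' x y z :=
    fun x y z => by
    refine Eq.trans ?_ (congrArg Subtype.val (congrFun hFm' ![x, y, z]))
    simp only [cornerOp]
    congr 2
    funext i; fin_cases i <;> rfl
  have hg : (fun v : Fin 3 → Q => e (F ![e (v 0) (v 1), v 1, e (v 2) (v 1)])
      (F' ![e (v 1) (v 0), v 1, e (v 1) (v 2)])) ∈ C 3 := by
    have hF₃ : (fun v : Fin 3 → Q => F ![v 0, v 1, v 2]) ∈ C 3 := by
      convert hF using 3 with v; funext i; fin_cases i <;> rfl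
    have hF₃' : (fun v : Fin 3 → Q => F' ![v 0, v 1, v 2]) ∈ C 3 := by
      convert hF' using 3 with v; funext i; fin_cases i <;> rfl
    exact hC.comp₂ he
      (hC.comp₃ (e := fun x y z => F ![x, y, z]) hF₃ (hC.comp₂ he (p 0) (p 1)) (p 1)
        (hC.comp₂ he (p 2) (p 1)))
      (hC.comp₃ (e := fun x y z => F' ![x, y, z]) hF₃' (hC.comp₂ he (p 1) (p 0)) (p 1)
        (hC.comp₂ he (p 1) (p 2)))
  have key : ∀ x u w, e u b = e x b → e b w = e b x → e u w = x := fun x u w hu hw => by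
    rw [← h₁ u b, hu, ← h₂ b w, hw, h₁, h₂, hC.idem₂ he]
  have hg₁ : ∀ x, e (F ![e x b, b, e b b]) (F' ![e b x, b, e b b]) = x := fun x => by
    rw [hb]
    refine key _ _ _ ((hM ⟨e x b, h₁ _ _ _⟩ ⟨b, hb⟩ ⟨b, hb⟩).trans ?_)
      ((hM' ⟨e b x, h₂ _ _ _⟩ ⟨b, hb⟩ ⟨b, hb⟩).trans ?_)
    · rw [hm₁]
    · rw [hm₁']
  have hg₂ : ∀ x, e (F ![e b b, b, e x b]) (F' ![e b b, b, e b x]) = x := fun x => by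
    rw [hb]
    refine key _ _ _ ((hM ⟨b, hb⟩ ⟨b, hb⟩ ⟨e x b, h₁ _ _ _⟩).trans ?_)
      ((hM' ⟨b, hb⟩ ⟨b, hb⟩ ⟨e b x, h₂ _ _ _⟩).trans ?_)
    · rw [hm₂]
    · rw [hm₂']
  exact hC.hasMaltsev_of_injective
    (g := fun x y z => e (F ![e x y, y, e z y]) (F' ![e y x, y, e y z])) hg b
    (LeftInverse.injective (g := id) hg₁) (LeftInverse.injective (g := id) hg₂)

end Corner

theorem hasMaltsev_or_hasProjHom {Q : Type*} [Finite Q] {C : ∀ n : ℕ, Set ((Fin n → Q) → Q)}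
    (hC : IsAbelianClone C) : HasMaltsev C ∨ HasProjHom C := by
  induction h : Nat.card Q using Nat.strong_induction_on generalizing Q with
  | _ N ih =>
  subst h
  rcases subsingleton_or_nontrivial Q with hQ | hQ
  · exact .inl ⟨fun x _ _ => x, hC.proj 3 0, fun _ _ => rfl, fun _ _ => Subsingleton.elim _ _⟩
  by_cases hL : IsLocal C
  · exact or_iff_not_imp_left.2 (hC.hasProjHom_of_isLocal hL)
  simp only [IsLocal, not_forall, not_or] at hL
  obtain ⟨e, he, h₁, h₂, hne₁, hne₂⟩ := hL
  obtain ⟨b⟩ : Nonempty Q := inferInstance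
  have he' : (fun v : Fin 2 → Q => e (v 1) (v 0)) ∈ C 2 :=
    hC.comp₂ he (hC.proj 2 1) (hC.proj 2 0)
  have h₁' : ∀ x y z, e z (e y x) = e z x := fun x y z => h₂ y x z
  have h₂' : ∀ x y z, e (e y x) z = e y z := fun x y z => h₁ y x z
  simp only [← not_forall] at hne₁ hne₂
  rcases ih _ (card_corner_lt h₁ b hne₁) (hC.cornerClone_isAbelianClone he h₁ h₂ b) rfl with hM | hP
  · rcases ih _ (card_corner_lt (e := fun x y => e y x) h₁' b fun h => hne₂ fun x y => h y x)
      (hC.cornerClone_isAbelianClone (e := fun x y => e y x) he' h₁' h₂' b) rfl with hM' | hP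
    · exact .inl (hC.hasMaltsev_of_corners he h₁ h₂ b hM hM')
    · exact .inr (hC.hasProjHom_of_cornerClone (e := fun x y => e y x) he' h₁' h₂' b hP)
  · exact .inr (hC.hasProjHom_of_cornerClone he h₁ h₂ b hP)

end IsAbelianClone

end Clone

section Realize

variable {L : FirstOrder.Language}

theorem map_realize {A B α : Type*} [L.Structure A] [L.Structure B] {h : A → B}
    (hh : ∀ (n : ℕ) (f : L.Functions n) (x : Fin n → A), h (funMap f x) = funMap f fun i => h (x i))
    (t : L.Term α) (w : α → A) : h (t.realize w) = t.realize fun i => h (w i) := by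
  induction t with
  | var i => rfl
  | func f ts ih => simp only [Term.realize_func, hh, ih]

theorem IsCong.realize {A α : Type*} [L.Structure A] {r : A → A → Prop} (hr : IsCong L A r)
    (t : L.Term α) {u v : α → A} (h : ∀ i, r (u i) (v i)) : r (t.realize u) (t.realize v) := by
  induction t with
  | var i => exact h i
  | func f ts ih => exact hr.2 _ f _ _ ih

theorem IsIdem.realize {A α : Type*} [L.Structure A] (hA : IsIdem L A) (t : L.Term α) (a : A) :
    t.realize (fun _ => a) = a := by
  induction t with
  | var i => rfl
  | func f ts ih => simp only [Term.realize_func, ih, hA _ f]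

theorem IsIdem.realize₃ {A : Type*} [L.Structure A] (hA : IsIdem L A) (t : L.Term (Fin 3)) (a : A) :
    t.realize ![a, a, a] = a := by
  rw [show (![a, a, a] : Fin 3 → A) = fun _ => a by funext i; fin_cases i <;> rfl, hA.realize]

theorem map_realize₃ {A B : Type*} [L.Structure A] [L.Structure B] {h : A → B}
    (hh : ∀ (n : ℕ) (f : L.Functions n) (x : Fin n → A), h (funMap f x) = funMap f fun i => h (x i))
    (t : L.Term (Fin 3)) (x y z : A) :
    h (t.realize ![x, y, z]) = t.realize ![h x, h y, h z] := by
  rw [map_realize hh]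
  congr 1
  funext i; fin_cases i <;> rfl

section Comap

variable {A B : Type*} [L.Structure A] [L.Structure B] {σ : B → B → Prop} {R : A → B}

theorem IsCong.comap_realize (hσ : IsCong L B σ)
    (hR : ∀ (n : ℕ) (f : L.Functions n) (x : Fin n → A),
      σ (R (funMap f x)) (funMap f fun i => R (x i))) {α : Type*} (t : L.Term α) (w : α → A) :
    σ (R (t.realize w)) (t.realize fun i => R (w i)) := by
  induction t with
  | var i => exact hσ.1.refl _
  | func f ts ih => exact hσ.1.trans (hR _ f _) (hσ.2 _ f _ _ ih)

theorem IsCong.comap (hσ : IsCong L B σ)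
    (hR : ∀ (n : ℕ) (f : L.Functions n) (x : Fin n → A),
      σ (R (funMap f x)) (funMap f fun i => R (x i))) :
    IsCong L A fun x y => σ (R x) (R y) :=
  ⟨⟨fun _ => hσ.1.refl _, fun h => hσ.1.symm h, fun h h' => hσ.1.trans h h'⟩, fun n f x y h =>
    hσ.1.trans (hR n f x) (hσ.1.trans (hσ.2 n f _ _ h) (hσ.1.symm (hR n f y)))⟩

theorem TermCond.comap (hσ : IsCong L B σ)
    (hR : ∀ (n : ℕ) (f : L.Functions n) (x : Fin n → A),
      σ (R (funMap f x)) (funMap f fun i => R (x i)))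
    {α β : B → B → Prop} {α' β' : A → A → Prop} (hα : ∀ x y, α' x y → α (R x) (R y))
    (hβ : ∀ x y, β' x y → β (R x) (R y)) (h : TermCond L B α β σ) :
    TermCond L A α' β' fun x y => σ (R x) (R y) := by
  intro n t a a' haa u v huv hs
  have key : ∀ (a : A) (u : Fin n → A),
      σ (R (t.realize (Fin.cons a u))) (t.realize (Fin.cons (R a) fun i => R (u i))) := by
    intro a u
    convert hσ.comap_realize hR t (Fin.cons a u) using 2
    funext i
    refine Fin.cases ?_ (fun i => ?_) i <;> simp
  refine hσ.1.trans (key _ _) (hσ.1.trans (h n t _ _ (hα _ _ haa) _ _ (fun i => hβ _ _ (huv i)) ?_)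
    (hσ.1.symm (key _ _)))
  exact hσ.1.trans (hσ.1.symm (key _ _)) (hσ.1.trans hs (key _ _))

end Comap

end Realize

section TermAlgebra

variable {L : FirstOrder.Language} [L.IsAlgebraic]

/-- The term algebra. -/
instance termStructure (α : Type*) : L.Structure (L.Term α) where
  funMap f ts := Term.func f ts
  RelMap r := isEmptyElim r

theorem realize_realize {α β B : Type*} [L.Structure B] (t : L.Term α) (g : α → L.Term β)
    (w : β → B) : (t.realize g).realize w = t.realize fun i => (g i).realize w :=
  map_realize (h := fun p : L.Term β => p.realize w) (fun _ _ _ => rfl) t g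

theorem realize_var (p : L.Term (Fin 2)) : p.realize (![Term.var 0, Term.var 1]) = p := by
  rw [show (![Term.var 0, Term.var 1] : Fin 2 → L.Term (Fin 2)) = Term.var by
    funext i; fin_cases i <;> rfl]
  induction p with
  | var i => rfl
  | func f ts ih => simp only [Term.realize_func, ih]; rfl

theorem realize_vec₃ {α B : Type*} [L.Structure B] (t : L.Term (Fin 3)) (p q r : L.Term α)
    (w : α → B) :
    (t.realize ![p, q, r]).realize w = t.realize ![p.realize w, q.realize w, r.realize w] := by
  rw [realize_realize]
  congr 1
  funext i; fin_cases i <;> rfl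

theorem realize_nested {B : Type*} [L.Structure B] (s t : L.Term (Fin 3)) (x y z : B) :
    (s.realize ![t, t.realize ![Term.var 1, Term.var 1, Term.var 2], Term.var 2]).realize
      ![x, y, z] = s.realize ![t.realize ![x, y, z], t.realize ![y, y, z], z] := by
  rw [realize_vec₃, realize_vec₃]
  rfl

/-- The term `t` witnesses the second condition on difference terms for the pair `(a, b)`, along
every abelian quotient of the algebra generated by `a` and `b`. -/
def IsWitness {A : Type*} [L.Structure A] (a b : A) (t : L.Term (Fin 3)) : Prop :=
  ∀ σ : L.Term (Fin 2) → L.Term (Fin 2) → Prop, IsCong L _ σ → TermCond L _ ⊤ ⊤ σ →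
    ∀ τ : Fin 2 → L.Term (Fin 2),
      (∀ p q : L.Term (Fin 2), p.realize ![a, b] = q.realize ![a, b] →
        σ (p.realize τ) (q.realize τ)) →
      σ (t.realize ![τ 0, τ 1, τ 1]) (τ 0)

theorem exists_isWitness {A : Type*} [L.Structure A]
    (H : letI : L.Structure (A × A) := prodStructure L A A
      ∀ x y z : A × A, ∃ d : L.Term (Fin 3),
        IsDTO L (↥(Substructure.closure L {x, y, z} : L.Substructure (A × A))) d)
    (a b c d : A) : ∃ t : L.Term (Fin 3), t.realize ![c, c, d] = d ∧ IsWitness a b t := by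
  let _ : L.Structure (A × A) := prodStructure L A A
  obtain ⟨t, ht⟩ := H (a, c) (b, c) (b, d)
  set E : L.Substructure (A × A) := Substructure.closure L {(a, c), (b, c), (b, d)} with hE
  have hsub : ({(a, c), (b, c), (b, d)} : Set (A × A)) ⊆ E := Substructure.subset_closure
  set α : E := ⟨(a, c), hsub (by simp)⟩ with hα
  set β : E := ⟨(b, c), hsub (by simp)⟩ with hβ
  set γ : E := ⟨(b, d), hsub (by simp)⟩ with hγ
  refine ⟨t, ?_, fun σ hσ hTC τ hτ => ?_⟩
  · have := congrArg (fun e : E => e.1.2) (ht β γ).1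
    rwa [map_realize₃ (h := fun e : E => e.1.2) (fun _ _ _ => rfl)] at this
  have hrep : ∀ e : E, ∃ p : L.Term (Fin 2), p.realize ![a, b] = e.1.1 := by
    rintro ⟨e, he⟩
    refine Substructure.closure_induction (p := fun e : A × A =>
      ∃ p : L.Term (Fin 2), p.realize ![a, b] = e.1) he ?_ fun {n} f x hx => ?_
    · rintro x (rfl | rfl | rfl)
      · exact ⟨Term.var 0, rfl⟩
      · exact ⟨Term.var 1, rfl⟩
      · exact ⟨Term.var 1, rfl⟩
    · choose p hp using hx
      exact ⟨Term.func f p, congrArg (funMap f) (funext hp)⟩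
  choose rep hrep using hrep
  set R : E → L.Term (Fin 2) := fun e => (rep e).realize τ with hR
  have hR' : ∀ (n : ℕ) (f : L.Functions n) (x : Fin n → E),
      σ (R (funMap f x)) (funMap f fun i => R (x i)) := fun n f x => by
    refine hτ _ (Term.func f fun i => rep (x i)) ?_
    simp only [hrep, Term.realize_func]; rfl
  have hRα : σ (R α) (τ 0) := hτ _ (Term.var 0) (hrep α)
  have hRβ : σ (R β) (τ 1) := hτ _ (Term.var 1) (hrep β)
  have key := (ht α β).2 _ (hσ.comap hR') (TermCond.comap hσ hR' (fun _ _ _ => trivial)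
    (fun _ _ _ => trivial) hTC)
  refine hσ.1.symm (hσ.1.trans (hσ.1.symm hRα) (hσ.1.trans key
    (hσ.1.trans (hσ.comap_realize hR' t _) (hσ.realize t fun i => ?_))))
  fin_cases i <;> assumption

/-- A failing pair for a congruence of the term algebra can be replaced by one at which the
congruence is controlled by evaluation at a single pair of elements. -/
theorem exists_evaluation {A : Type*} [L.Structure A] [Finite A] (hidem : IsIdem L A)
    {σ : L.Term (Fin 2) → L.Term (Fin 2) → Prop}
    (hEq : ∀ p q : L.Term (Fin 2), (∀ w : Fin 2 → A, p.realize w = q.realize w) → σ p q)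
    {x y : L.Term (Fin 2)} (hxy : ¬ σ x y) :
    ∃ (a b : A) (τ : Fin 2 → L.Term (Fin 2)), ¬ σ (τ 0) (τ 1) ∧
      ∀ p q : L.Term (Fin 2), p.realize ![a, b] = q.realize ![a, b] →
        σ (p.realize τ) (q.realize τ) := by
  obtain ⟨Y, -, ⟨⟨τ₁, τ₂, hY, hτ⟩, hmax⟩⟩ := Finite.exists_le_maximal
    (p := fun Y : Set (Fin 2 → A) => ∃ τ₁ τ₂ : L.Term (Fin 2),
      (∀ w ∈ Y, τ₁.realize w = τ₂.realize w) ∧ ¬ σ τ₁ τ₂)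
    (a := ∅) ⟨x, y, by simp, hxy⟩
  obtain ⟨w, hw⟩ : ∃ w, τ₁.realize w ≠ τ₂.realize w := by
    by_contra! h; exact hτ (hEq _ _ h)
  refine ⟨τ₁.realize w, τ₂.realize w, ![τ₁, τ₂], hτ, fun p q hpq => ?_⟩
  by_contra hne
  have hev : ∀ (p : L.Term (Fin 2)) (w : Fin 2 → A), (p.realize ![τ₁, τ₂]).realize w =
      p.realize ![τ₁.realize w, τ₂.realize w] := fun p w => by
    rw [realize_realize]
    congr 1
    funext i; fin_cases i <;> rfl
  have hwY : w ∈ Y := by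
    refine hmax (y := insert w Y) ⟨_, _, ?_, hne⟩ (Set.subset_insert _ _) (Set.mem_insert _ _)
    rintro v (rfl | hv)
    · rw [hev, hev, hpq]
    · have hc : (![τ₁.realize v, τ₂.realize v] : Fin 2 → A) = fun _ => τ₁.realize v := by
        funext i; fin_cases i <;> simp [hY v hv]
      rw [hev, hev, hc, hidem.realize, hidem.realize]
  exact hw (hY w hwY)

end TermAlgebra

section AbelianQuotient

variable {L : FirstOrder.Language} [L.IsAlgebraic]

/-- `π` presents `Q` as an abelian quotient of the free algebra on two generators in the variety
generated by `A`. -/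
structure IsAbelianQuotient (A : Type*) [L.Structure A] {Q : Type*} [L.Structure Q]
    (π : L.Term (Fin 2) → Q) : Prop where
  map : ∀ (n : ℕ) (f : L.Functions n) (x : Fin n → L.Term (Fin 2)),
    π (funMap f x) = funMap f fun i => π (x i)
  surj : Function.Surjective π
  eq_of : ∀ p q : L.Term (Fin 2), (∀ w : Fin 2 → A, p.realize w = q.realize w) → π p = π q
  termCond : TermCond L (L.Term (Fin 2)) ⊤ ⊤ fun p q => π p = π q

/-- The term operations of a structure. -/
def termOps (L : FirstOrder.Language) (Q : Type*) [L.Structure Q] (n : ℕ) :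
    Set ((Fin n → Q) → Q) :=
  Set.range fun (t : L.Term (Fin n)) w => t.realize w

namespace IsAbelianQuotient

variable {A : Type*} [L.Structure A] {Q : Type*} [L.Structure Q] {π : L.Term (Fin 2) → Q}

theorem realize_eq {α : Type*} (hπ : IsAbelianQuotient A π) {s t : L.Term α}
    (h : ∀ w : α → A, s.realize w = t.realize w) (w : α → Q) : s.realize w = t.realize w := by
  choose g hg using hπ.surj
  rw [show w = fun i => π (g (w i)) by simp only [hg], ← map_realize hπ.map,
    ← map_realize hπ.map]
  exact hπ.eq_of _ _ fun v => by rw [realize_realize, realize_realize, h]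

theorem isIdem (hπ : IsAbelianQuotient A π) (hidem : IsIdem L A) : IsIdem L Q := fun n f a =>
  hπ.realize_eq (s := Term.func f fun _ => Term.var (0 : Fin 1)) (t := Term.var 0)
    (fun w => hidem n f (w 0)) fun _ => a

theorem finite [Finite A] (hπ : IsAbelianQuotient A π) : Finite Q := by
  choose g hg using hπ.surj
  refine Finite.of_injective (fun q (w : Fin 2 → A) => (g q).realize w) fun q q' h => ?_
  rw [← hg q, ← hg q']
  exact hπ.eq_of _ _ (congrFun h)

theorem rect {α : Type*} [Finite α] (hπ : IsAbelianQuotient A π) (t : L.Term α)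
    (w₁ w₂ w₃ w₄ : α → Q)
    (hw : ∀ i, w₁ i = w₂ i ∧ w₃ i = w₄ i ∨ w₁ i = w₃ i ∧ w₂ i = w₄ i)
    (h : t.realize w₁ = t.realize w₂) : t.realize w₃ = t.realize w₄ := by
  classical
  obtain ⟨n, ⟨ε⟩⟩ := Finite.exists_equiv_fin α
  have := Fintype.ofFinite α
  have hTC : ∀ (s : L.Term (Fin (n + 1))) (a a' : Q) (u v : Fin n → Q),
      s.realize (Fin.cons a u) = s.realize (Fin.cons a v) →
        s.realize (Fin.cons a' u) = s.realize (Fin.cons a' v) := by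
    intro s a a' u v hs
    choose g hg using hπ.surj
    have key : ∀ (a : Q) (u : Fin n → Q), s.realize (Fin.cons a u) =
        π (s.realize (Fin.cons (g a) fun i => g (u i))) := by
      intro a u
      rw [map_realize hπ.map]
      congr 1
      funext i
      refine Fin.cases ?_ (fun i => ?_) i <;> simp [hg]
    rw [key, key] at hs ⊢
    exact hπ.termCond n s _ _ trivial _ _ (fun _ => trivial) hs
  have main : ∀ s : Finset α, t.realize (s.piecewise w₃ w₁) = t.realize (s.piecewise w₄ w₂) := by
    intro s
    induction s using Finset.induction_on with
    | empty => simpa using h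
    | insert j s hj ih =>
      rw [Finset.piecewise_insert, Finset.piecewise_insert]
      rcases hw j with ⟨h₁, h₂⟩ | ⟨h₁, h₂⟩
      · have key : ∀ (w : α → Q) (a : Q), t.realize (Function.update w j a) =
            (t.relabel fun i => if i = j then (0 : Fin (n + 1)) else (ε i).succ).realize
              (Fin.cons a fun k => w (ε.symm k)) := by
          intro w a
          rw [Term.realize_relabel]
          congr 1
          funext i
          by_cases hi : i = j
          · subst hi; simp
          · simp [hi]
        rw [h₂, key, key]
        refine hTC _ (w₁ j) _ _ _ ?_
        rw [← key, ← key]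
        convert ih using 2
        · rw [Function.update_eq_self_iff]; simp [hj]
        · rw [Function.update_eq_self_iff]; simp [hj, h₁]
      · rw [Function.update_eq_self_iff.2, Function.update_eq_self_iff.2, ih]
        · simp [hj, h₂]
        · simp [hj, h₁]
  simpa using main Finset.univ

theorem isAbelianClone (hπ : IsAbelianQuotient A π) (hidem : IsIdem L A) :
    IsAbelianClone (termOps L Q) where
  proj n i := ⟨Term.var i, rfl⟩
  comp := by
    rintro n m _ ⟨t, rfl⟩ g hg
    choose τ hτ using hg
    exact ⟨t.subst τ, by simp only [← hτ, Term.realize_subst]⟩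
  idem := by
    rintro n _ ⟨t, rfl⟩ a
    exact (hπ.isIdem hidem).realize t a
  rect := by
    rintro n _ ⟨t, rfl⟩ w₁ w₂ w₃ w₄ hw h
    exact hπ.rect t w₁ w₂ w₃ w₄ hw h

theorem exists_maltsev [Finite A] (hπ : IsAbelianQuotient A π) (hidem : IsIdem L A)
    (H : ∀ a b c d : A, ∃ t : L.Term (Fin 3), t.realize ![c, c, d] = d ∧ IsWitness a b t) :
    ∃ m : L.Term (Fin 3), ∀ x y : Q, m.realize ![x, y, y] = x ∧ m.realize ![x, x, y] = y := by
  have := hπ.finite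
  rcases (hπ.isAbelianClone hidem).hasMaltsev_or_hasProjHom with ⟨m, ⟨t, ht⟩, h₁, h₂⟩ | ⟨ξ, hp, hc⟩
  · refine ⟨t, fun x y => ⟨?_, ?_⟩⟩
    · exact (congrFun ht ![x, y, y]).trans (h₁ x y)
    · exact (congrFun ht ![x, x, y]).trans (h₂ x y)
  exfalso
  obtain ⟨X, hvar, hcomp, hcongr⟩ : ∃ X : ∀ n : ℕ, L.Term (Fin n) → Fin n,
      (∀ n i, X n (Term.var i) = i) ∧
      (∀ n m (t : L.Term (Fin n)) (g : Fin n → L.Term (Fin m)),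
        X m (t.realize g) = X m (g (X n t))) ∧
      ∀ n (s t : L.Term (Fin n)), (∀ w : Fin n → Q, s.realize w = t.realize w) →
        X n s = X n t := by
    refine ⟨fun n t => ξ n (fun w => t.realize w) ⟨t, rfl⟩, fun n i => hp n i _,
      fun n m t g => ?_, fun n s t h => by simp only [h]⟩
    have hmem : (fun w : Fin m → Q => t.realize fun i => (g i).realize w) ∈ termOps L Q m :=
      ⟨t.realize g, funext fun w => realize_realize _ _ _⟩
    refine Eq.trans ?_ (hc n m (fun w => t.realize w) ⟨t, rfl⟩ (fun i w => (g i).realize w)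
      (fun i => ⟨g i, rfl⟩) hmem)
    simp only [realize_realize]
  have hfunc : ∀ (n : ℕ) (f : L.Functions n) (x : Fin n → L.Term (Fin 2)),
      X 2 (funMap f x) = X 2 (x (X n (Term.func f Term.var))) := fun n f x =>
    hcomp n 2 (Term.func f Term.var) x
  set σ : L.Term (Fin 2) → L.Term (Fin 2) → Prop := fun p q => X 2 p = X 2 q with hσ
  have hcong : IsCong L _ σ := ⟨⟨fun _ => rfl, Eq.symm, Eq.trans⟩, fun n f x y h => by
    simp only [hσ, hfunc]; exact h _⟩
  have hTC : TermCond L _ ⊤ ⊤ σ := by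
    intro n t a a' _ u v _ h
    simp only [hσ, hcomp] at h ⊢
    revert h
    refine Fin.cases (fun _ => rfl) (fun i => ?_) (X _ t)
    simp only [Fin.cons_succ, imp_self]
  have hEq : ∀ p q : L.Term (Fin 2), (∀ w : Fin 2 → A, p.realize w = q.realize w) → σ p q := by
    exact fun p q h => hcongr 2 p q (hπ.realize_eq h)
  obtain ⟨a, b, τ, hne, hτ⟩ := exists_evaluation hidem hEq (x := Term.var 0) (y := Term.var 1)
    (by simp only [hσ, hvar]; decide)
  obtain ⟨t, ht, hw⟩ := H a b a b
  have h₁ : σ _ _ := hw σ hcong hTC τ hτ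
  have h₂ : σ (t.realize ![τ 0, τ 0, τ 1]) (τ 1) := by
    have := hτ (t.realize ![Term.var 0, Term.var 0, Term.var 1]) (Term.var 1)
      (by rw [realize_vec₃]; exact ht)
    rwa [realize_vec₃] at this
  simp only [hσ, hcomp] at h₁ h₂ hne
  generalize X _ t = k at h₁ h₂
  fin_cases k
  · exact hne h₂
  · exact hne h₁.symm
  · exact hne h₁.symm

theorem maltsev_comm {α : Type*} [Finite α] (hπ : IsAbelianQuotient A π)
    {m : L.Term (Fin 3)}
    (hm : ∀ x y : Q, m.realize ![x, y, y] = x ∧ m.realize ![x, x, y] = y) (t : L.Term α)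
    (x y z : α → Q) : m.realize ![t.realize x, t.realize y, t.realize z] =
      t.realize fun i => m.realize ![x i, y i, z i] := by
  set Φ : L.Term (Option (α × Fin 3)) := m.subst ![m.subst fun k => t.relabel fun i => some (i, k),
    t.subst fun i => m.relabel fun k => some (i, k), Term.var none] with hΦ
  have hreal : ∀ (x y z : α → Q) (w : Q),
      Φ.realize (fun o : Option (α × Fin 3) => o.elim w fun ik => ![x ik.1, y ik.1, z ik.1] ik.2) =
        m.realize ![m.realize ![t.realize x, t.realize y, t.realize z],
          t.realize fun i => m.realize ![x i, y i, z i], w] := by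
    intro x y z w
    rw [hΦ, Term.realize_subst]
    congr 1
    funext k
    fin_cases k
    · simp only [Fin.zero_eta, Matrix.cons_val_zero, Term.realize_subst, Term.realize_relabel]
      congr 1
      funext k; fin_cases k <;> rfl
    · simp only [Fin.mk_one, Matrix.cons_val_one, Matrix.cons_val_zero, Term.realize_subst,
        Term.realize_relabel]
      congr 1
    · rfl
  have key : ∀ w : Q, m.realize ![m.realize ![t.realize x, t.realize y, t.realize z],
      t.realize fun i => m.realize ![x i, y i, z i], w] = w := by
    intro w
    rw [← hreal]
    refine (hπ.rect Φ
      (fun o : Option (α × Fin 3) => o.elim w fun ik => ![y ik.1, y ik.1, z ik.1] ik.2)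
      (fun o : Option (α × Fin 3) => o.elim w fun ik => ![y ik.1, y ik.1, y ik.1] ik.2) _
      (fun o : Option (α × Fin 3) => o.elim w fun ik => ![x ik.1, y ik.1, y ik.1] ik.2) ?_ ?_).trans
      ?_
    · rintro (_ | ⟨i, k⟩)
      · simp
      · fin_cases k <;> simp
    · simp only [hreal, hm]
    · simp only [hreal, hm]
  exact (hm _ (t.realize fun i => m.realize ![x i, y i, z i])).1.symm.trans (key _)

theorem exists_local [Finite A] (hπ : IsAbelianQuotient A π) (hidem : IsIdem L A)
    (H : ∀ a b c d : A, ∃ t : L.Term (Fin 3), t.realize ![c, c, d] = d ∧ IsWitness a b t)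
    (c d : A) : ∃ t : L.Term (Fin 3), t.realize ![c, c, d] = d ∧
      t.realize ![π (Term.var 0), π (Term.var 1), π (Term.var 1)] = π (Term.var 0) := by
  obtain ⟨m, hm⟩ := hπ.exists_maltsev hidem H
  have hQ := hπ.isIdem hidem
  have hm₁ : ∀ x y : Q, m.realize ![x, y, y] = x := fun x y => (hm x y).1
  have hm₂ : ∀ x y : Q, m.realize ![x, x, y] = y := fun x y => (hm x y).2
  set x₀ := π (Term.var 0) with hx₀
  set y₀ := π (Term.var 1) with hy₀
  set I : Set Q := {q | ∃ t : L.Term (Fin 3), t.realize ![c, c, d] = d ∧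
    t.realize ![x₀, y₀, y₀] = q} with hI
  have hy₀I : y₀ ∈ I := ⟨Term.var 2, rfl, rfl⟩
  have hIcl : ∀ {n : ℕ} (t : L.Term (Fin n)) (w : Fin n → Q), (∀ i, w i ∈ I) → t.realize w ∈ I := by
    intro n t w hw
    choose s hs hs' using hw
    refine ⟨t.subst s, ?_, ?_⟩
    · simp only [Term.realize_subst, hs, hidem.realize]
    · simp only [Term.realize_subst, hs']
  have hIm : ∀ {p q r : Q}, p ∈ I → q ∈ I → r ∈ I → m.realize ![p, q, r] ∈ I := by
    intro p q r hp hq hr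
    exact hIcl m _ fun i => by fin_cases i <;> assumption
  have hmm : ∀ p₁ p₂ p₃ q₁ q₂ q₃ r₁ r₂ r₃ : Q,
      m.realize ![m.realize ![p₁, p₂, p₃], m.realize ![q₁, q₂, q₃], m.realize ![r₁, r₂, r₃] ] =
        m.realize ![m.realize ![p₁, q₁, r₁], m.realize ![p₂, q₂, r₂], m.realize ![p₃, q₃, r₃] ] := by
    intro p₁ p₂ p₃ q₁ q₂ q₃ r₁ r₂ r₃
    rw [hπ.maltsev_comm hm]
    congr 1
    funext i; fin_cases i <;> rfl
  set σ : L.Term (Fin 2) → L.Term (Fin 2) → Prop := fun p q => m.realize ![π p, π q, y₀] ∈ I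
    with hσ
  have hterm : ∀ {n : ℕ} (t : L.Term (Fin n)) (u v : Fin n → L.Term (Fin 2)),
      m.realize ![π (t.realize u), π (t.realize v), y₀] =
        t.realize fun i => m.realize ![π (u i), π (v i), y₀] := by
    intro n t u v
    rw [map_realize hπ.map, map_realize hπ.map]
    nth_rw 1 [← hQ.realize t y₀]
    rw [hπ.maltsev_comm hm]
  have hcong : IsCong L _ σ := by
    refine ⟨⟨fun p => ?_, fun {p q} h => ?_, fun {p q r} h h' => ?_⟩, fun n f u v h => ?_⟩
    · simpa only [hσ, hm₂] using hy₀I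
    · have e := hmm (π q) (π q) y₀ (π p) (π q) y₀ (π p) (π p) y₀
      simp only [hm₁, hm₂] at e
      simp only [hσ, ← e]
      exact hIm hy₀I h hy₀I
    · have e := hmm (π p) (π q) y₀ (π q) (π q) y₀ (π q) (π r) y₀
      simp only [hm₁, hm₂] at e
      simp only [hσ, ← e]
      exact hIm h hy₀I h'
    · have e := hterm (Term.func f Term.var) u v
      simp only [Term.realize_func, Term.realize_var] at e
      simp only [hσ, e]
      exact hIcl (Term.func f Term.var) _ h
  have hTC : TermCond L _ ⊤ ⊤ σ := by
    intro n t a a' _ u v _ h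
    have key : ∀ a : L.Term (Fin 2),
        m.realize ![π (t.realize (Fin.cons a u)), π (t.realize (Fin.cons a v)), y₀] =
          t.realize (Fin.cons y₀ fun i => m.realize ![π (u i), π (v i), y₀]) := by
      intro a
      rw [hterm]
      congr 1
      funext i
      refine Fin.cases ?_ (fun i => ?_) i
      · simp only [Fin.cons_zero, hm₂]
      · simp only [Fin.cons_succ]
    simp only [hσ, key] at h ⊢
    exact h
  have hEq : ∀ p q : L.Term (Fin 2), (∀ w : Fin 2 → A, p.realize w = q.realize w) → σ p q := by
    intro p q h
    simpa only [hσ, hπ.eq_of p q h, hm₂] using hy₀I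
  by_cases hxy : σ (Term.var 0) (Term.var 1)
  · obtain ⟨t, h₁, h₂⟩ := hxy
    exact ⟨t, h₁, h₂.trans (hm₁ _ _)⟩
  exfalso
  obtain ⟨a, b, τ, hne, hτ⟩ := exists_evaluation hidem hEq hxy
  obtain ⟨t, ht, hw⟩ := H a b c d
  have h₁ : σ _ _ := hw σ hcong hTC τ hτ
  refine hne (hcong.1.trans (hcong.1.symm h₁) ?_)
  set W := m.realize ![τ 0, τ 1, Term.var 1] with hW
  have hWπ : π W = m.realize ![π (τ 0), π (τ 1), y₀] := map_realize₃ hπ.map _ _ _ _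
  have hWr : W.realize ![x₀, y₀] = π W := by
    conv_rhs => rw [← realize_var W, map_realize hπ.map]
    congr 1
    funext i; fin_cases i <;> rfl
  have hval : m.realize ![π (t.realize ![τ 0, τ 1, τ 1]), π (τ 1), y₀] =
      t.realize ![π W, y₀, y₀] := by
    have e := hterm t ![τ 0, τ 1, τ 1] ![τ 1, τ 1, τ 1]
    rw [show t.realize ![τ 1, τ 1, τ 1] = t.realize fun _ => τ 1 by
      congr 1; funext i; fin_cases i <;> rfl, map_realize hπ.map t fun _ => τ 1,
      hQ.realize] at e
    rw [e, hWπ]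
    congr 1
    funext i
    fin_cases i
    · rfl
    · exact hm₂ _ _
    · exact hm₂ _ _
  refine ⟨t.subst ![W.relabel ![0, 1], Term.var 1, Term.var 2], ?_, ?_⟩
  · rw [Term.realize_subst]
    refine Eq.trans ?_ ht
    congr 1
    funext i
    fin_cases i
    · simp only [Fin.zero_eta, Matrix.cons_val_zero, Term.realize_relabel]
      refine Eq.trans ?_ (hidem.realize W c)
      congr 1
      funext i; fin_cases i <;> rfl
    · rfl
    · rfl
  · rw [Term.realize_subst]
    refine Eq.trans ?_ hval.symm
    congr 1
    funext i
    fin_cases i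
    · simp only [Fin.zero_eta, Matrix.cons_val_zero, Term.realize_relabel]
      rw [← hWr]
      congr 1
      funext i; fin_cases i <;> rfl
    · rfl
    · rfl

theorem exists_global [Finite A] (hπ : IsAbelianQuotient A π) (hidem : IsIdem L A)
    (H : ∀ a b c d : A, ∃ t : L.Term (Fin 3), t.realize ![c, c, d] = d ∧ IsWitness a b t) :
    ∃ t : L.Term (Fin 3), (∀ c d : A, t.realize ![c, c, d] = d) ∧
      t.realize ![π (Term.var 0), π (Term.var 1), π (Term.var 1)] = π (Term.var 0) := by
  classical
  suffices h : ∀ s : Finset (A × A), ∃ t : L.Term (Fin 3),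
      (∀ p ∈ s, t.realize ![p.1, p.1, p.2] = p.2) ∧
      t.realize ![π (Term.var 0), π (Term.var 1), π (Term.var 1)] = π (Term.var 0) by
    have := Fintype.ofFinite (A × A)
    obtain ⟨t, h₁, h₂⟩ := h Finset.univ
    exact ⟨t, fun c d => h₁ (c, d) (Finset.mem_univ _), h₂⟩
  intro s
  induction s using Finset.induction_on with
  | empty => exact ⟨Term.var 0, by simp, rfl⟩
  | insert p s _ ih =>
    obtain ⟨t₁, h₁, h₁'⟩ := ih
    obtain ⟨t₂, h₂, h₂'⟩ := hπ.exists_local hidem H (t₁.realize ![p.1, p.1, p.2]) p.2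
    refine ⟨t₂.realize ![t₁, t₁.realize ![Term.var 1, Term.var 1, Term.var 2], Term.var 2],
      fun q hq => ?_, ?_⟩
    · rw [realize_nested]
      rcases Finset.mem_insert.1 hq with rfl | hq
      · exact h₂
      · rw [h₁ q hq, hidem.realize₃]
    · rw [realize_nested, h₁', (hπ.isIdem hidem).realize₃, h₂']

end IsAbelianQuotient

end AbelianQuotient

section DifferenceTerm

variable {L : FirstOrder.Language}

theorem cgPair_isCong {A : Type*} [L.Structure A] (a b : A) : IsCong L A (cgPair L A a b) :=
  ⟨⟨fun x _ hr _ => hr.1.refl x, fun h r hr hs => hr.1.symm (h r hr hs),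
    fun h h' r hr hs => hr.1.trans (h r hr hs) (h' r hr hs)⟩,
    fun n f _ _ h r hr hs => hr.2 n f _ _ fun i => h i r hr hs⟩

theorem cgPair_self {A : Type*} [L.Structure A] (a b : A) : cgPair L A a b a b :=
  fun _ _ hs => hs (a, b) rfl

theorem IsDTO.of_surjective {A B : Type*} [L.Structure A] [L.Structure B] {h : A → B}
    (hh : ∀ (n : ℕ) (f : L.Functions n) (x : Fin n → A), h (funMap f x) = funMap f fun i => h (x i))
    (hs : Function.Surjective h) {d : L.Term (Fin 3)} (hd : IsDTO L A d) : IsDTO L B d := by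
  intro x y
  obtain ⟨a, rfl⟩ := hs x
  obtain ⟨b, rfl⟩ := hs y
  refine ⟨by rw [← map_realize₃ hh, (hd a b).1], fun δ hδ hTC => ?_⟩
  rw [← map_realize₃ hh]
  have hle : ∀ u v, cgPair L A a b u v → cgPair L B (h a) (h b) (h u) (h v) := fun u v huv =>
    huv _ ((cgPair_isCong (h a) (h b)).comap fun n f x => by
      rw [hh]; exact (cgPair_isCong _ _).1.refl _) (by rintro _ rfl; exact cgPair_self _ _)
  have hδR : ∀ (n : ℕ) (f : L.Functions n) (x : Fin n → A),
      δ (h (funMap f x)) (funMap f fun i => h (x i)) := fun n f x => by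
    rw [hh]; exact hδ.1.refl _
  exact (hd a b).2 _ (hδ.comap hδR) (TermCond.comap hδ hδR hle hle hTC)

variable [L.IsAlgebraic]

theorem exists_term_of_forall_exists_isWitness {A : Type*} [L.Structure A] [Finite A]
    (hidem : IsIdem L A)
    (H : ∀ a b c d : A, ∃ t : L.Term (Fin 3), t.realize ![c, c, d] = d ∧ IsWitness a b t) :
    ∃ t : L.Term (Fin 3), (∀ c d : A, t.realize ![c, c, d] = d) ∧
      ∀ δ : L.Term (Fin 2) → L.Term (Fin 2) → Prop, IsCong L _ δ →
        (∀ p q : L.Term (Fin 2), (∀ w : Fin 2 → A, p.realize w = q.realize w) → δ p q) →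
        TermCond L _ ⊤ ⊤ δ →
        δ (t.realize ![Term.var 0, Term.var 1, Term.var 1]) (Term.var 0) := by
  let s : Setoid (L.Term (Fin 2)) :=
    { r := fun x y => ∀ δ : L.Term (Fin 2) → L.Term (Fin 2) → Prop, IsCong L _ δ →
        (∀ p q : L.Term (Fin 2), (∀ w : Fin 2 → A, p.realize w = q.realize w) → δ p q) →
        TermCond L _ ⊤ ⊤ δ → δ x y
      iseqv := ⟨fun x δ hδ _ _ => hδ.1.refl x, fun h δ hδ h₁ h₂ => hδ.1.symm (h δ hδ h₁ h₂),
        fun h h' δ hδ h₁ h₂ => hδ.1.trans (h δ hδ h₁ h₂) (h' δ hδ h₁ h₂)⟩ }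
  let _ : L.Structure (Quotient s) := quotStructure L _ s
  have hπ : IsAbelianQuotient A (Quotient.mk s) :=
    { map := fun n f x => Quotient.sound fun δ hδ h₁ h₂ => hδ.2 n f _ _ fun i =>
        hδ.1.symm (Quotient.mk_out (s := s) (x i) δ hδ h₁ h₂)
      surj := Quotient.mk_surjective
      eq_of := fun p q h => Quotient.sound fun δ _ h₁ _ => h₁ p q h
      termCond := fun n t a a' haa u v huv h => Quotient.sound fun δ hδ h₁ h₂ =>
        h₂ n t a a' haa u v huv (Quotient.exact h δ hδ h₁ h₂) }
  obtain ⟨t, h₁, h₂⟩ := hπ.exists_global hidem H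
  rw [← map_realize₃ hπ.map] at h₂
  exact ⟨t, h₁, Quotient.exact h₂⟩

theorem isDTO_of_forall {A : Type*} [L.Structure A] (hidem : IsIdem L A) {t : L.Term (Fin 3)}
    (h₁ : ∀ c d : A, t.realize ![c, c, d] = d)
    (h₂ : ∀ δ : L.Term (Fin 2) → L.Term (Fin 2) → Prop, IsCong L _ δ →
      (∀ p q : L.Term (Fin 2), (∀ w : Fin 2 → A, p.realize w = q.realize w) → δ p q) →
      TermCond L _ ⊤ ⊤ δ → δ (t.realize ![Term.var 0, Term.var 1, Term.var 1]) (Term.var 0))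
    {B : Type*} [L.Structure B]
    (hB : ∀ (n : ℕ) (t₁ t₂ : L.Term (Fin n)),
      (∀ w : Fin n → A, t₁.realize w = t₂.realize w) →
        ∀ w : Fin n → B, t₁.realize w = t₂.realize w) : IsDTO L B t := by
  have hidemB : IsIdem L B := fun n f b =>
    hB 1 (Term.func f fun _ => Term.var 0) (Term.var 0) (fun w => hidem n f (w 0)) fun _ => b
  intro a b
  constructor
  · have := hB 2 (t.realize ![Term.var 0, Term.var 0, Term.var 1]) (Term.var 1)
      (fun w => by rw [realize_vec₃]; exact h₁ _ _) ![a, b]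
    rwa [realize_vec₃] at this
  · intro δ hδ hTC
    have hR : ∀ (n : ℕ) (f : L.Functions n) (x : Fin n → L.Term (Fin 2)),
        δ ((funMap f x : L.Term (Fin 2)).realize ![a, b])
          (funMap f fun i => (x i).realize ![a, b]) := fun n f x => hδ.1.refl _
    have hθ : ∀ p : L.Term (Fin 2), cgPair L B a b a (p.realize ![a, b]) := fun p => by
      have := (cgPair_isCong a b).realize p (u := fun _ => a) (v := ![a, b]) fun i => by
        fin_cases i
        · exact (cgPair_isCong a b).1.refl _
        · exact cgPair_self a b
      rwa [hidemB.realize] at this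
    have hθ' : ∀ p q : L.Term (Fin 2), (⊤ : L.Term (Fin 2) → L.Term (Fin 2) → Prop) p q →
        cgPair L B a b (p.realize ![a, b]) (q.realize ![a, b]) := fun p q _ =>
      (cgPair_isCong a b).1.trans ((cgPair_isCong a b).1.symm (hθ p)) (hθ q)
    have := h₂ _ (hδ.comap hR) (fun p q h => by rw [hB 2 p q h]; exact hδ.1.refl _)
      (TermCond.comap hδ hR hθ' hθ' hTC)
    rw [realize_vec₃] at this
    exact hδ.1.symm this

/-- The algebra structure transported along a bijection. -/
def comapStructure {A B : Type*} [L.Structure A] (ε : B ≃ A) : L.Structure B where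
  funMap f x := ε.symm (funMap f fun i => ε (x i))
  RelMap r := isEmptyElim r

theorem exists_isDTO_of_finite {A E : Type*} [L.Structure A] [L.Structure E] [Finite E]
    (hE : ∀ (n : ℕ) (t₁ t₂ : L.Term (Fin n)),
      (∀ w : Fin n → A, t₁.realize w = t₂.realize w) →
        ∀ w : Fin n → E, t₁.realize w = t₂.realize w) {d : L.Term (Fin 3)}
    (hd : ∀ (B : Type v) (_ : L.Structure B),
      (∀ (n : ℕ) (t₁ t₂ : L.Term (Fin n)),
        (∀ w : Fin n → A, t₁.realize w = t₂.realize w) →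
          ∀ w : Fin n → B, t₁.realize w = t₂.realize w) → IsDTO L B d) : IsDTO L E d := by
  obtain ⟨n, ⟨ε⟩⟩ := Finite.exists_equiv_fin E
  let ε' : ULift.{v} (Fin n) ≃ E := Equiv.ulift.trans ε.symm
  let _ : L.Structure (ULift.{v} (Fin n)) := comapStructure ε'
  have hh : ∀ (k : ℕ) (f : L.Functions k) (x : Fin k → ULift.{v} (Fin n)),
      ε' (funMap f x) = funMap f fun i => ε' (x i) := fun k f x => ε'.apply_symm_apply _
  refine IsDTO.of_surjective hh ε'.surjective (hd _ _ fun k t₁ t₂ h w => ε'.injective ?_)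
  rw [map_realize hh, map_realize hh, hE k t₁ t₂ h]

end DifferenceTerm

theorem stmt3 {L : FirstOrder.Language} [L.IsAlgebraic] (A : Type u) [L.Structure A] [Finite A]
    (hidem : IsIdem L A) :
    (∃ d : L.Term (Fin 3), ∀ (B : Type v) (_ : L.Structure B),
        (∀ (n : ℕ) (t₁ t₂ : L.Term (Fin n)),
          (∀ w : Fin n → A, t₁.realize w = t₂.realize w) →
          ∀ w : Fin n → B, t₁.realize w = t₂.realize w) →
        IsDTO L B d) ↔
      (letI : L.Structure (A × A) := prodStructure L A A
       ∀ x y z : A × A, ∃ d : L.Term (Fin 3),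
          IsDTO L (↥(Substructure.closure L {x, y, z} : L.Substructure (A × A))) d) := by
  constructor
  · rintro ⟨d, hd⟩
    let _ : L.Structure (A × A) := prodStructure L A A
    intro x y z
    refine ⟨d, exists_isDTO_of_finite (A := A) (fun n t₁ t₂ h w => Subtype.ext (Prod.ext ?_ ?_)) hd⟩
    · rw [map_realize (h := fun e : Substructure.closure L {x, y, z} => e.1.1) fun _ _ _ => rfl,
        map_realize (h := fun e : Substructure.closure L {x, y, z} => e.1.1) fun _ _ _ => rfl, h]
    · rw [map_realize (h := fun e : Substructure.closure L {x, y, z} => e.1.2) fun _ _ _ => rfl,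
        map_realize (h := fun e : Substructure.closure L {x, y, z} => e.1.2) fun _ _ _ => rfl, h]
  · intro H
    obtain ⟨t, h₁, h₂⟩ := exists_term_of_forall_exists_isWitness hidem (exists_isWitness H)
    exact ⟨t, fun B _ hB => isDTO_of_forall hidem h₁ h₂ hB⟩
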